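/- Let X be a smooth Radon plane that is not isometrically isomorphic to the two-dimensional Euclidean space ℓ₂², and let I be a nonempty set. Then X ⊕_∞ c₀(I) =_BJ ℓ₂² ⊕_∞ c₀(I), but there is no surjective linear isometry between X ⊕_∞ c₀(I) and ℓ₂² ⊕_∞ c₀(I). -/

import Mathlib

open ZeroAtInfty

/-- Birkhoff–James orthogonality: `x ⊥_BJ y` iff `‖x + λ y‖ ≥ ‖x‖` for all `λ : ℝ`. -/
def BJOrth {X : Type*} [NormedAddCommGroup X] [NormedSpace ℝ X] (x y : X) : Prop :=
  ∀ l : ℝ, ‖x‖ ≤ ‖x + l • y‖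

/-- A normed space is smooth if the set of supporting functionals at every nonzero
point is a singleton. -/
def SmoothSpace (X : Type*) [NormedAddCommGroup X] [NormedSpace ℝ X] : Prop :=
  ∀ x : X, x ≠ 0 → ∃ f : X →L[ℝ] ℝ, {g : X →L[ℝ] ℝ | ‖g‖ ≤ 1 ∧ g x = ‖x‖} = {f}

/-- `X =_BJ Y`: there is a norm-preserving homogeneous homeomorphism between `X` and `Y`
preserving Birkhoff–James orthogonality in both directions. -/
def BJStrongIso (X Y : Type*) [NormedAddCommGroup X] [NormedSpace ℝ X]
    [NormedAddCommGroup Y] [NormedSpace ℝ Y] : Prop :=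
  ∃ T : X ≃ₜ Y, (∀ x : X, ‖T x‖ = ‖x‖) ∧ (∀ (c : ℝ) (x : X), T (c • x) = c • T x) ∧
    ∀ x y : X, BJOrth x y ↔ BJOrth (T x) (T y)

open Filter Topology

/-- One-sided Birkhoff–James orthogonality. -/
def PosOrth {X : Type*} [NormedAddCommGroup X] [NormedSpace ℝ X] (x y : X) : Prop :=
  ∀ l : ℝ, 0 ≤ l → ‖x‖ ≤ ‖x + l • y‖

section PosOrth

variable {X Y : Type*} [NormedAddCommGroup X] [NormedSpace ℝ X]
  [NormedAddCommGroup Y] [NormedSpace ℝ Y]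

lemma bjOrth_iff_posOrth {x y : X} : BJOrth x y ↔ PosOrth x y ∧ PosOrth x (-y) := by
  refine ⟨fun h ↦ ⟨fun l _ ↦ h l, fun l _ ↦ ?_⟩, fun h l ↦ ?_⟩
  · simpa using h (-l)
  · rcases le_total 0 l with hl | hl
    · exact h.1 l hl
    · simpa using h.2 (-l) (by linarith)

lemma eventually_norm_add_smul_lt {x y : X} {r : ℝ} (hr : ‖x‖ ≤ r)
    (h : r ≤ ‖x‖ → ¬ PosOrth x y) : ∀ᶠ l : ℝ in 𝓝[>] 0, ‖x + l • y‖ < r := by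
  rcases hr.lt_or_eq with hlt | rfl
  · have hc : Tendsto (fun l : ℝ ↦ ‖x + l • y‖) (𝓝 0) (𝓝 ‖x + (0 : ℝ) • y‖) :=
      (by fun_prop : Continuous fun l : ℝ ↦ ‖x + l • y‖).tendsto 0
    exact nhdsWithin_le_nhds (hc.eventually_lt_const (by simpa using hlt))
  · have h' := h le_rfl
    simp only [PosOrth, not_forall, not_le] at h'
    obtain ⟨m, hm0, hm⟩ := h'
    have hmpos : 0 < m := by
      rcases hm0.lt_or_eq with h0 | rfl
      · exact h0
      · simp at hm
    filter_upwards [Ioo_mem_nhdsGT hmpos] with l hl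
    have hq : l / m < 1 := (div_lt_one hmpos).2 hl.2
    have hq0 : 0 < l / m := div_pos hl.1 hmpos
    have hxl : x + l • y = (1 - l / m) • x + (l / m) • (x + m • y) := by
      rw [smul_add, smul_smul, div_mul_cancel₀ _ hmpos.ne']
      module
    calc ‖x + l • y‖ ≤ ‖(1 - l / m) • x‖ + ‖(l / m) • (x + m • y)‖ := hxl ▸ norm_add_le _ _
      _ = (1 - l / m) * ‖x‖ + (l / m) * ‖x + m • y‖ := by
        rw [norm_smul, norm_smul, Real.norm_of_nonneg (by linarith), Real.norm_of_nonneg hq0.le]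
      _ < ‖x‖ := by nlinarith

lemma posOrth_prod_iff {x y : X × Y} :
    PosOrth x y ↔ (‖x.2‖ ≤ ‖x.1‖ ∧ PosOrth x.1 y.1) ∨ (‖x.1‖ ≤ ‖x.2‖ ∧ PosOrth x.2 y.2) := by
  constructor
  · intro h
    by_contra! hcon
    have e1 := eventually_norm_add_smul_lt (y := y.1) (norm_fst_le x)
      fun hle ↦ hcon.1 ((norm_snd_le x).trans hle)
    have e2 := eventually_norm_add_smul_lt (y := y.2) (norm_snd_le x)
      fun hle ↦ hcon.2 ((norm_fst_le x).trans hle)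
    obtain ⟨l, ⟨h1, h2⟩, hl⟩ := ((e1.and e2).and self_mem_nhdsWithin).exists
    have := h l (le_of_lt hl)
    rw [Prod.norm_def (x + l • y)] at this
    exact absurd this (not_le.2 (max_lt h1 h2))
  · rintro (⟨hle, h⟩ | ⟨hle, h⟩) l hl
    · rw [Prod.norm_def x, max_eq_left hle]
      exact (h l hl).trans (norm_fst_le (x + l • y))
    · rw [Prod.norm_def x, max_eq_right hle]
      exact (h l hl).trans (norm_snd_le (x + l • y))

lemma bjStrongIso_prod {X' : Type*} [NormedAddCommGroup X'] [NormedSpace ℝ X'] (S : X ≃ₜ X')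
    (hnorm : ∀ x, ‖S x‖ = ‖x‖) (hsmul : ∀ (c : ℝ) x, S (c • x) = c • S x)
    (horth : ∀ x y, PosOrth x y ↔ PosOrth (S x) (S y)) : BJStrongIso (X × Y) (X' × Y) := by
  have key : ∀ x y : X × Y, PosOrth x y ↔ PosOrth (S x.1, x.2) (S y.1, y.2) := fun x y ↦ by
    simp only [posOrth_prod_iff, hnorm, ← horth]
  refine ⟨S.prodCongr (Homeomorph.refl Y), fun x ↦ ?_, fun c x ↦ ?_, fun x y ↦ ?_⟩
  · simp [Prod.norm_def, hnorm]
  · exact Prod.ext (hsmul c x.1) rfl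
  · have hneg : ((S.prodCongr (Homeomorph.refl Y)) (-y)) =
        -((S.prodCongr (Homeomorph.refl Y)) y) := by
      have := hsmul (-1) y.1
      simp only [neg_smul, one_smul] at this
      exact Prod.ext this rfl
    rw [bjOrth_iff_posOrth, bjOrth_iff_posOrth, ← hneg, key, key]
    rfl

end PosOrth

lemma posOrth_iff_inner {E : Type*} [NormedAddCommGroup E] [InnerProductSpace ℝ E] {x y : E} :
    PosOrth x y ↔ 0 ≤ inner ℝ x y := by
  have hexp : ∀ l : ℝ, ‖x + l • y‖ ^ 2 = ‖x‖ ^ 2 + 2 * (l * inner ℝ x y) + l ^ 2 * ‖y‖ ^ 2 := by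
    intro l
    rw [norm_add_sq_real, inner_smul_right, norm_smul, mul_pow, Real.norm_eq_abs, sq_abs]
  constructor
  · intro h
    by_contra! hneg
    have hy : 0 < ‖y‖ ^ 2 := by
      have : y ≠ 0 := by rintro rfl; simp at hneg
      positivity
    have h1 := h (-inner ℝ x y / ‖y‖ ^ 2) (by apply div_nonneg <;> linarith)
    have h2 := pow_le_pow_left₀ (norm_nonneg x) h1 2
    rw [hexp] at h2
    have h3 : (-inner ℝ x y / ‖y‖ ^ 2) ^ 2 * ‖y‖ ^ 2 =
        (-inner ℝ x y / ‖y‖ ^ 2) * (-inner ℝ x y) := by field_simp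
    have h4 : 0 < -inner ℝ x y / ‖y‖ ^ 2 := div_pos (by linarith) hy
    nlinarith
  · intro h l hl
    refine le_of_sq_le_sq ?_ (norm_nonneg _)
    rw [hexp]
    have := mul_nonneg hl h
    have := mul_nonneg (sq_nonneg l) (sq_nonneg ‖y‖)
    linarith

section Rigidity

variable {E Y : Type*} [NormedAddCommGroup E] [NormedSpace ℝ E]
  [NormedAddCommGroup Y] [NormedSpace ℝ Y]

/-- A functional splitting off a one-dimensional `ℓ_∞`-summand of `E ⊕_∞ Y` vanishes on `E`
if `E` is strictly convex of dimension at least two. -/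
lemma apply_inl_eq_zero_of_norm_add_smul_eq_max [StrictConvexSpace ℝ E]
    [FiniteDimensional ℝ E] (hE : 1 < Module.finrank ℝ E) (φ : (E × Y) →ₗ[ℝ] ℝ) (d : E × Y)
    (hd : φ d = 1) (h : ∀ w, φ w = 0 → ∀ c : ℝ, ‖w + c • d‖ = max |c| ‖w‖) (e : E) :
    φ (e, 0) = 0 := by
  have hd1 : d.1 = 0 := by
    obtain ⟨e₀, he₀, hne⟩ := (Submodule.ne_bot_iff _).1
      (LinearMap.ker_ne_bot_of_finrank_lt (f := φ ∘ₗ LinearMap.inl ℝ E Y) (by simpa using hE))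
    have hle : ∀ c : ℝ, |c| = ‖e₀‖ → ‖e₀ + c • d.1‖ ≤ ‖e₀‖ := fun c hc ↦ by
      have h1 := h (e₀, 0) (by simpa using he₀) c
      rw [hc, Prod.norm_def (e₀, (0 : Y))] at h1
      simp only [norm_zero, norm_nonneg, sup_of_le_left, max_self] at h1
      exact h1 ▸ norm_fst_le ((e₀, (0 : Y)) + c • d)
    by_contra hd1
    have hpos : ‖e₀‖ ≠ 0 := norm_ne_zero_iff.2 hne
    have hlt := norm_combo_lt_of_ne (a := 1 / 2) (b := 1 / 2) (hle ‖e₀‖ (by simp))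
      (hle (-‖e₀‖) (by simp)) (fun heq ↦ by
        have h2 : (2 * ‖e₀‖) • d.1 = 0 := by
          have := sub_eq_zero.2 heq
          rw [← this]; module
        rcases smul_eq_zero.1 h2 with h3 | h3
        · exact hpos (by linarith)
        · exact hd1 h3) (by norm_num) (by norm_num) (by norm_num)
    have heq : (1 / 2 : ℝ) • (e₀ + ‖e₀‖ • d.1) + (1 / 2 : ℝ) • (e₀ + (-‖e₀‖) • d.1) = e₀ := by
      module
    rw [heq] at hlt
    exact lt_irrefl _ hlt
  have hd2 : ‖d.2‖ = 1 := by
    have := h 0 (map_zero φ) 1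
    simpa [Prod.norm_def, hd1] using this
  by_contra hne
  set a := φ (e, 0) with ha
  have hapos : 0 < |a| := abs_pos.2 hne
  set t : ℝ := ‖e‖ + |a| with ht
  have htpos : 0 ≤ t := by positivity
  have hw : φ ((e, 0) - a • d) = 0 := by rw [map_sub, map_smul, hd, ← ha]; simp
  have habs : ∀ c : ℝ, |c| = t → |c - a| ≤ t := by
    intro c hc
    have h1 := h _ hw c
    have h2 : ‖(e, 0) - a • d‖ ≤ t := by
      have h3 : (e, 0) - a • d = (e, (-a) • d.2) := by
        ext <;> simp [hd1]
      rw [h3, Prod.norm_def, norm_smul, hd2]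
      simp [ht]
    have h4 : ‖((e, 0) - a • d + c • d).2‖ = |c - a| := by
      have : ((e, 0) - a • d + c • d).2 = (c - a) • d.2 := by simp; module
      rw [this, norm_smul, hd2, mul_one, Real.norm_eq_abs]
    rw [← h4]
    refine (norm_snd_le _).trans ?_
    rw [h1, hc]
    exact max_le le_rfl h2
  have h5 := (abs_le.1 (habs t (abs_of_nonneg htpos))).2
  have h6 := (abs_le.1 (habs (-t) (by rw [abs_neg, abs_of_nonneg htpos]))).1
  exact hne (by linarith)

end Rigidity

section C0

variable {I : Type*} [TopologicalSpace I]

lemma abs_apply_le_norm (a : C₀(I, ℝ)) (i : I) : |a i| ≤ ‖a‖ :=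
  a.toBCF.norm_coe_le_norm i

variable [DiscreteTopology I]

open Classical in
/-- The unit vector of `c₀(I)` supported at `i`. -/
noncomputable def c0Single (i : I) : C₀(I, ℝ) where
  toFun := fun j ↦ if j = i then 1 else 0
  continuous_toFun := continuous_of_discreteTopology
  zero_at_infty' := by
    rw [cocompact_eq_cofinite]
    refine tendsto_const_nhds.congr' ?_
    filter_upwards [(Set.finite_singleton i).compl_mem_cofinite] with j hj
    exact (if_neg hj).symm

lemma c0Single_self (i : I) : c0Single i i = 1 := if_pos rfl

lemma c0Single_of_ne {i j : I} (h : j ≠ i) : c0Single i j = 0 := if_neg h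

lemma norm_add_smul_c0Single {a : C₀(I, ℝ)} {i : I} (hi : a i = 0) (c : ℝ) :
    ‖a + c • c0Single i‖ = max |c| ‖a‖ := by
  have happ : ∀ j, (a + c • c0Single i) j = a j + c * c0Single i j := fun j ↦ rfl
  apply le_antisymm
  · rw [← ZeroAtInftyContinuousMap.norm_toBCF_eq_norm, BoundedContinuousFunction.norm_le
      (le_max_of_le_left (abs_nonneg c))]
    intro j
    change |(a + c • c0Single i) j| ≤ _
    rw [happ]
    by_cases hj : j = i
    · subst hj; simp [hi, c0Single_self]
    · simp [c0Single_of_ne hj, abs_apply_le_norm]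
  · refine max_le ?_ ?_
    · simpa [happ, hi, c0Single_self] using abs_apply_le_norm (a + c • c0Single i) i
    · rw [← ZeroAtInftyContinuousMap.norm_toBCF_eq_norm,
        BoundedContinuousFunction.norm_le (norm_nonneg _)]
      intro j
      change |a j| ≤ _
      by_cases hj : j = i
      · subst hj; simp [hi]
      · simpa [happ, c0Single_of_ne hj] using abs_apply_le_norm (a + c • c0Single i) j

/-- An isometry `X ⊕_∞ c₀(I) → E ⊕_∞ c₀(I)` identifies the plane summands. -/
lemma nonempty_linearIsometryEquiv_of_prod_c0 {X E : Type*} [NormedAddCommGroup X]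
    [NormedSpace ℝ X] [FiniteDimensional ℝ X] [NormedAddCommGroup E] [NormedSpace ℝ E]
    [FiniteDimensional ℝ E] [StrictConvexSpace ℝ E] (hE : 1 < Module.finrank ℝ E)
    (hXE : Module.finrank ℝ X = Module.finrank ℝ E)
    (T : (X × C₀(I, ℝ)) ≃ₗᵢ[ℝ] (E × C₀(I, ℝ))) : Nonempty (X ≃ₗᵢ[ℝ] E) := by
  have hzero : ∀ e : E, (T.symm (e, 0)).2 = 0 := by
    intro e
    ext i
    let φ : (E × C₀(I, ℝ)) →ₗ[ℝ] ℝ :=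
      { toFun := fun w ↦ (T.symm w).2 i
        map_add' := fun _ _ ↦ by simp
        map_smul' := fun _ _ ↦ by simp }
    refine apply_inl_eq_zero_of_norm_add_smul_eq_max hE φ (T (0, c0Single i)) ?_ ?_ e
    · simp [φ, c0Single_self]
    · intro w hw c
      have hw' : (T.symm w).2 i = 0 := hw
      rw [← T.symm.norm_map, ← T.symm.norm_map w, map_add, map_smul, T.symm_apply_apply,
        Prod.norm_def, Prod.norm_def (T.symm w)]
      simp only [Prod.fst_add, Prod.smul_fst, smul_zero, add_zero, Prod.snd_add, Prod.smul_snd,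
        norm_add_smul_c0Single hw']
      exact max_left_comm _ _ _
  let L : E →ₗᵢ[ℝ] X :=
    { toFun := fun e ↦ (T.symm (e, 0)).1
      map_add' := fun a b ↦ by
        rw [← Prod.fst_add, ← map_add, Prod.mk_add_mk, add_zero]
      map_smul' := fun c a ↦ by
        rw [RingHom.id_apply, ← Prod.smul_fst, ← map_smul, Prod.smul_mk, smul_zero]
      norm_map' := fun e ↦ by
        have h := T.symm.norm_map (e, 0)
        rw [Prod.norm_def, hzero e, Prod.norm_def] at h
        simpa using h }
  exact ⟨(L.toLinearIsometryEquiv hXE.symm).symm⟩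

end C0

/-- `f` assigns to every nonzero `x` its unique supporting functional. -/
structure IsSupportMap {X : Type*} [NormedAddCommGroup X] [NormedSpace ℝ X]
    (f : X → X →L[ℝ] ℝ) : Prop where
  norm_le : ∀ x, ‖f x‖ ≤ 1
  apply_self : ∀ x, f x x = ‖x‖
  eq_of_apply_eq : ∀ x ≠ 0, ∀ g : X →L[ℝ] ℝ, ‖g‖ ≤ 1 → g x = ‖x‖ → g = f x

lemma SmoothSpace.exists_isSupportMap {X : Type*} [NormedAddCommGroup X] [NormedSpace ℝ X]
    (h : SmoothSpace X) : ∃ f : X → X →L[ℝ] ℝ, IsSupportMap f := by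
  have key : ∀ x : X, ∃ g : X →L[ℝ] ℝ, ‖g‖ ≤ 1 ∧ g x = ‖x‖ ∧
      (x ≠ 0 → ∀ g' : X →L[ℝ] ℝ, ‖g'‖ ≤ 1 → g' x = ‖x‖ → g' = g) := by
    intro x
    by_cases hx : x = 0
    · exact ⟨0, by simp, by simp [hx], fun h ↦ absurd hx h⟩
    · obtain ⟨g, hg⟩ := h x hx
      have hmem : g ∈ {g : X →L[ℝ] ℝ | ‖g‖ ≤ 1 ∧ g x = ‖x‖} := hg ▸ rfl
      exact ⟨g, hmem.1, hmem.2, fun _ g' h1 h2 ↦ hg.subset ⟨h1, h2⟩⟩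
  choose f hf using key
  exact ⟨f, fun x ↦ (hf x).1, fun x ↦ (hf x).2.1, fun x ↦ (hf x).2.2⟩

namespace IsSupportMap

variable {X : Type*} [NormedAddCommGroup X] [NormedSpace ℝ X] {f : X → X →L[ℝ] ℝ}

lemma apply_le (hf : IsSupportMap f) (x y : X) : f x y ≤ ‖y‖ :=
  (le_abs_self _).trans ((f x).le_of_opNorm_le (hf.norm_le x) y |>.trans_eq (one_mul _))

lemma smul_of_pos (hf : IsSupportMap f) {c : ℝ} (hc : 0 < c) {x : X} (hx : x ≠ 0) :
    f (c • x) = f x := by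
  refine hf.eq_of_apply_eq x hx _ (hf.norm_le _) (mul_left_cancel₀ hc.ne' ?_)
  rw [← smul_eq_mul, ← map_smul, hf.apply_self, norm_smul, Real.norm_of_nonneg hc.le]

lemma neg (hf : IsSupportMap f) {x : X} (hx : x ≠ 0) : f (-x) = -f x := by
  refine (hf.eq_of_apply_eq (-x) (neg_ne_zero.2 hx) _ ?_ ?_).symm
  · rw [norm_neg]; exact hf.norm_le x
  · simp [hf.apply_self]

lemma continuousOn [FiniteDimensional ℝ X] (hf : IsSupportMap f) : ContinuousOn f {0}ᶜ := by
  intro x hx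
  refine ContinuousAt.continuousWithinAt ?_
  refine (isCompact_closedBall (0 : X →L[ℝ] ℝ) 1).tendsto_nhds_of_unique_mapClusterPt
    (Eventually.of_forall fun y ↦ by simpa using hf.norm_le y) fun g hg hcl ↦ ?_
  obtain ⟨U, hU, hUg⟩ := mapClusterPt_iff_ultrafilter.1 hcl
  refine hf.eq_of_apply_eq x hx g (by simpa using hg) ?_
  have h1 : Tendsto (fun y ↦ f y y) U (𝓝 (g x)) :=
    (isBoundedBilinearMap_apply.continuous.tendsto (g, x)).comp (hUg.prodMk_nhds hU)
  simp_rw [hf.apply_self] at h1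
  exact tendsto_nhds_unique h1 (continuous_norm.continuousAt.tendsto.mono_left hU)

lemma posOrth_iff [FiniteDimensional ℝ X] (hf : IsSupportMap f) {x y : X} (hx : x ≠ 0) :
    PosOrth x y ↔ 0 ≤ f x y := by
  constructor
  · intro h
    have hc : Tendsto (fun l : ℝ ↦ f (x + l • y) y) (𝓝[>] 0) (𝓝 (f x y)) := by
      have h1 : Tendsto (fun l : ℝ ↦ x + l • y) (𝓝[>] 0) (𝓝 x) := by
        have := (by fun_prop : Continuous fun l : ℝ ↦ x + l • y).tendsto 0
        simp only [zero_smul, add_zero] at this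
        exact this.mono_left nhdsWithin_le_nhds
      have h2 : ContinuousAt f x := hf.continuousOn.continuousAt (isOpen_ne.mem_nhds hx)
      exact (isBoundedBilinearMap_apply.continuous.tendsto (f x, y)).comp
        ((h2.tendsto.comp h1).prodMk_nhds tendsto_const_nhds)
    refine ge_of_tendsto hc ?_
    filter_upwards [self_mem_nhdsWithin] with l hl
    have hl : 0 < l := hl
    have h1 := h l hl.le
    rw [← hf.apply_self (x + l • y), map_add, map_smul, smul_eq_mul] at h1
    have h2 := hf.apply_le (x + l • y) x
    by_contra! hneg
    nlinarith
  · intro h l hl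
    refine le_trans ?_ (hf.apply_le x (x + l • y))
    rw [map_add, map_smul, hf.apply_self, smul_eq_mul]
    nlinarith

lemma bjOrth_iff [FiniteDimensional ℝ X] (hf : IsSupportMap f) {x y : X} (hx : x ≠ 0) :
    BJOrth x y ↔ f x y = 0 := by
  rw [bjOrth_iff_posOrth, hf.posOrth_iff hx, hf.posOrth_iff hx, map_neg, neg_nonneg, and_comm,
    ← le_antisymm_iff]

lemma sign_apply_comm [FiniteDimensional ℝ X] (hf : IsSupportMap f)
    (hradon : ∀ x y : X, BJOrth x y → BJOrth y x) {x y : X} (hx : x ≠ 0) (hy : y ≠ 0) :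
    SignType.sign (f x y) = SignType.sign (f y x) := by
  have hzero : ∀ {x y : X}, x ≠ 0 → y ≠ 0 → f x y = 0 → f y x = 0 := fun hx hy h ↦
    (hf.bjOrth_iff hy).1 (hradon _ _ ((hf.bjOrth_iff hx).2 h))
  have hpos : ∀ {x y : X}, x ≠ 0 → y ≠ 0 → 0 < f y x → 0 < f x y := by
    intro x y hx hy h
    by_contra! hle
    have hconv : IsPreconnected {z | 0 < f y z} :=
      (convex_halfSpace_gt (f y).isBoundedLinearMap.toIsLinearMap 0).isPreconnected
    have hne : ∀ z ∈ {z | 0 < f y z}, z ≠ 0 := by rintro z hz rfl; simp at hz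
    have hcont : ContinuousOn (fun z ↦ f z y) {z | 0 < f y z} :=
      (hf.continuousOn.mono hne).clm_apply continuousOn_const
    have hyy : 0 < f y y := by rw [hf.apply_self]; exact norm_pos_iff.2 hy
    obtain ⟨z, hz, hz0⟩ := hconv.intermediate_value (a := x) (b := y) h hyy hcont
      ⟨hle, hyy.le⟩
    exact hz.ne' (hzero (hne z hz) hy hz0)
  rcases lt_trichotomy (f x y) 0 with h | h | h
  · have h1 : 0 < f x (-y) := by simpa using h
    have h2 := hpos (neg_ne_zero.2 hy) hx h1
    rw [hf.neg hy] at h2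
    rw [sign_neg h, sign_neg (by simpa using h2)]
  · rw [h, hzero hx hy h]
  · rw [sign_pos h, sign_pos (hpos hy hx h)]

end IsSupportMap

lemma nonneg_add_iff_of_sign_eq {p q p' q' : ℝ} (hp : SignType.sign p = SignType.sign p')
    (hq : SignType.sign q = SignType.sign q') (h : 0 ≤ p * q) : 0 ≤ p + q ↔ 0 ≤ p' + q' := by
  have hp0 : 0 ≤ p ↔ 0 ≤ p' := by rw [← sign_nonneg_iff, hp, sign_nonneg_iff]
  have hp1 : p ≤ 0 ↔ p' ≤ 0 := by rw [← sign_nonpos_iff, hp, sign_nonpos_iff]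
  have hq0 : 0 ≤ q ↔ 0 ≤ q' := by rw [← sign_nonneg_iff, hq, sign_nonneg_iff]
  have hq1 : q ≤ 0 ↔ q' ≤ 0 := by rw [← sign_nonpos_iff, hq, sign_nonpos_iff]
  rcases mul_nonneg_iff.1 h with ⟨h1, h2⟩ | ⟨h1, h2⟩
  · exact iff_of_true (add_nonneg h1 h2) (add_nonneg (hp0.1 h1) (hq0.1 h2))
  · have h1' := hp1.1 h1
    have h2' := hq1.1 h2
    constructor <;> intro h3
    · exact add_nonneg (hp0.1 (by linarith)) (hq0.1 (by linarith))
    · exact add_nonneg (hp0.2 (by linarith)) (hq0.2 (by linarith))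

lemma abs_mul_eq_abs_mul_of_sign_eq {a b : ℝ} (h : SignType.sign a = SignType.sign b) :
    |b| * a = |a| * b := by
  conv_lhs => rw [← sign_mul_abs a, h]
  conv_rhs => rw [← sign_mul_abs b]
  ring

lemma inv_norm_smul_eq_of_sign_eq {a b : EuclideanSpace ℝ (Fin 2)}
    (h : ∀ i, SignType.sign (a i) = SignType.sign (b i)) (h0 : a 0 * a 1 = 0) :
    ‖a‖⁻¹ • a = ‖b‖⁻¹ • b := by
  have hz : ∀ i, a i = 0 ↔ b i = 0 := fun i ↦ by rw [← sign_eq_zero_iff, h, sign_eq_zero_iff]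
  by_cases ha : a = 0
  · have hb : b = 0 := by
      ext i
      exact (hz i).1 (by simp [ha])
    rw [ha, hb]
  have hb : b ≠ 0 := fun hb ↦ ha (by ext i; exact (hz i).2 (by simp [hb]))
  refine (sameRay_iff_inv_norm_smul_eq_of_ne ha hb).1 (Or.inr (Or.inr ?_))
  rcases mul_eq_zero.1 h0 with hi | hi
  · have hi' := (hz 0).1 hi
    have h1 : a 1 ≠ 0 := fun h1 ↦ ha (by ext i; fin_cases i <;> simp [hi, h1])
    have h2 := mt (hz 1).2 h1
    refine ⟨|b 1|, |a 1|, abs_pos.2 h2, abs_pos.2 h1, ?_⟩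
    ext i
    fin_cases i
    · simp [hi, hi']
    · simpa using abs_mul_eq_abs_mul_of_sign_eq (h 1)
  · have hi' := (hz 1).1 hi
    have h1 : a 0 ≠ 0 := fun h1 ↦ ha (by ext i; fin_cases i <;> simp [hi, h1])
    have h2 := mt (hz 0).2 h1
    refine ⟨|b 0|, |a 0|, abs_pos.2 h2, abs_pos.2 h1, ?_⟩
    ext i
    fin_cases i
    · simpa using abs_mul_eq_abs_mul_of_sign_eq (h 0)
    · simp [hi, hi']

lemma continuous_norm_smul_inv_norm_smul {X E : Type*} [NormedAddCommGroup X]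
    [NormedAddCommGroup E] [NormedSpace ℝ E] {g : X → E}
    (hg : ContinuousOn g {0}ᶜ) (hg0 : ∀ x ≠ 0, g x ≠ 0) :
    Continuous fun x ↦ ‖x‖ • ‖g x‖⁻¹ • g x := by
  rw [continuous_iff_continuousAt]
  intro x
  by_cases hx : x = 0
  · subst hx
    rw [ContinuousAt, norm_zero, zero_smul]
    refine squeeze_zero_norm (fun y ↦ ?_) (tendsto_norm_zero (E := X))
    rw [norm_smul, norm_norm, norm_smul, norm_inv, norm_norm]
    exact mul_le_of_le_one_right (norm_nonneg y) inv_mul_le_one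
  · have h1 : ContinuousAt g x := hg.continuousAt (isOpen_ne.mem_nhds hx)
    exact continuous_norm.continuousAt.smul
      ((h1.norm.inv₀ (norm_ne_zero_iff.2 (hg0 x hx))).smul h1)

/-- A pair of mutually Birkhoff–James orthogonal unit vectors of a smooth Radon plane, with
`f` the support map. -/
structure IsRadonFrame {X : Type*} [NormedAddCommGroup X] [NormedSpace ℝ X]
    (f : X → X →L[ℝ] ℝ) (u v : X) : Prop extends IsSupportMap f where
  sign_comm : ∀ x ≠ 0, ∀ y ≠ 0, SignType.sign (f x y) = SignType.sign (f y x)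
  norm_left : ‖u‖ = 1
  norm_right : ‖v‖ = 1
  apply_left_right : f u v = 0
  apply_right_left : f v u = 0
  decomp : ∀ x, f u x • u + f v x • v = x

lemma exists_isRadonFrame {X : Type*} [NormedAddCommGroup X] [NormedSpace ℝ X]
    (hdim : Module.finrank ℝ X = 2) (hsmooth : SmoothSpace X)
    (hradon : ∀ x y : X, BJOrth x y → BJOrth y x) :
    ∃ (f : X → X →L[ℝ] ℝ) (u v : X), IsRadonFrame f u v := by
  have : FiniteDimensional ℝ X := Module.finite_of_finrank_pos (by omega)
  have : Nontrivial X := Module.nontrivial_of_finrank_pos (R := ℝ) (by omega)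
  obtain ⟨f, hf⟩ := hsmooth.exists_isSupportMap
  obtain ⟨u, hu⟩ := exists_norm_eq X zero_le_one
  have hu0 : u ≠ 0 := norm_ne_zero_iff.1 (by simp [hu])
  obtain ⟨v', hv', hv'0⟩ := (Submodule.ne_bot_iff _).1
    (LinearMap.ker_ne_bot_of_finrank_lt (f := (f u).toLinearMap) (by simp [hdim]))
  have hv'1 : ‖v'‖ ≠ 0 := norm_ne_zero_iff.2 hv'0
  set v := ‖v'‖⁻¹ • v' with hv_def
  have hv : ‖v‖ = 1 := by simp [hv_def, norm_smul, hv'1]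
  have hv0 : v ≠ 0 := norm_ne_zero_iff.1 (by simp [hv])
  have hv'2 : f u v' = 0 := hv'
  have huv : f u v = 0 := by rw [hv_def, map_smul, hv'2, smul_zero]
  have hvu : f v u = 0 := (hf.bjOrth_iff hv0).1 (hradon _ _ ((hf.bjOrth_iff hu0).2 huv))
  have huu : f u u = 1 := by rw [hf.apply_self, hu]
  have hvv : f v v = 1 := by rw [hf.apply_self, hv]
  have hli : LinearIndependent ℝ ![u, v] := by
    rw [LinearIndependent.pair_iff]
    intro s t hst
    have h1 := congrArg (f u) hst
    have h2 := congrArg (f v) hst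
    simp only [map_add, map_smul, smul_eq_mul, huu, huv, hvu, hvv, map_zero] at h1 h2
    exact ⟨by linarith, by linarith⟩
  refine ⟨f, u, v, hf, fun x hx y hy ↦ hf.sign_apply_comm hradon hx hy, hu, hv, huv, hvu,
    fun x ↦ ?_⟩
  have hx : x ∈ Submodule.span ℝ (Set.range ![u, v]) := by
    rw [hli.span_eq_top_of_card_eq_finrank (by simp [hdim])]
    trivial
  rw [Matrix.range_cons, Matrix.range_cons, Matrix.range_empty, Set.union_empty,
    Set.singleton_union, Submodule.mem_span_pair] at hx
  obtain ⟨a, b, rfl⟩ := hx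
  simp [huu, huv, hvu, hvv]

/-- Coordinates of `x` in the frame. -/
noncomputable def primalCoords {X : Type*} [NormedAddCommGroup X] [NormedSpace ℝ X]
    (f : X → X →L[ℝ] ℝ) (u v x : X) : EuclideanSpace ℝ (Fin 2) := !₂[f u x, f v x]

/-- Coordinates of the supporting functional of `x` in the dual frame. -/
noncomputable def dualCoords {X : Type*} [NormedAddCommGroup X] [NormedSpace ℝ X]
    (f : X → X →L[ℝ] ℝ) (u v x : X) : EuclideanSpace ℝ (Fin 2) := !₂[f x u, f x v]

open Classical in
/-- The direction of the image of `x`: its coordinates in one pair of opposite quadrants, and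
the coordinates of its supporting functional in the other. -/
noncomputable def frameDir {X : Type*} [NormedAddCommGroup X] [NormedSpace ℝ X]
    (f : X → X →L[ℝ] ℝ) (u v x : X) : EuclideanSpace ℝ (Fin 2) :=
  if 0 ≤ f u x * f v x then primalCoords f u v x else dualCoords f u v x

/-- The norm-preserving map to the Euclidean plane sending `x` in the direction `frameDir`. -/
noncomputable def frameMap {X : Type*} [NormedAddCommGroup X] [NormedSpace ℝ X]
    (f : X → X →L[ℝ] ℝ) (u v x : X) : EuclideanSpace ℝ (Fin 2) :=
  ‖x‖ • ‖frameDir f u v x‖⁻¹ • frameDir f u v x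

namespace IsRadonFrame

variable {X : Type*} [NormedAddCommGroup X] [NormedSpace ℝ X]
  {f : X → X →L[ℝ] ℝ} {u v x y : X}

lemma left_ne_zero (h : IsRadonFrame f u v) : u ≠ 0 := norm_ne_zero_iff.1 (by simp [h.norm_left])

lemma right_ne_zero (h : IsRadonFrame f u v) : v ≠ 0 := norm_ne_zero_iff.1 (by simp [h.norm_right])

lemma ext (h : IsRadonFrame f u v) (hu : f u x = f u y) (hv : f v x = f v y) : x = y := by
  rw [← h.decomp x, hu, hv, h.decomp]

lemma sign_coords (h : IsRadonFrame f u v) (hx : x ≠ 0) (i : Fin 2) :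
    SignType.sign (primalCoords f u v x i) = SignType.sign (dualCoords f u v x i) := by
  fin_cases i
  · exact h.sign_comm u h.left_ne_zero x hx
  · exact h.sign_comm v h.right_ne_zero x hx

lemma inner_dualCoords (h : IsRadonFrame f u v) (x y : X) :
    inner ℝ (dualCoords f u v x) (primalCoords f u v y) = f x y := by
  conv_rhs => rw [← h.decomp y]
  simp [PiLp.inner_apply, primalCoords, dualCoords]

lemma primalCoords_ne_zero (h : IsRadonFrame f u v) (hx : x ≠ 0) : primalCoords f u v x ≠ 0 := by
  intro h0
  have h1 := h.inner_dualCoords x x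
  rw [h0, inner_zero_right, h.apply_self] at h1
  exact hx (norm_eq_zero.1 h1.symm)

lemma dualCoords_ne_zero (h : IsRadonFrame f u v) (hx : x ≠ 0) : dualCoords f u v x ≠ 0 := by
  intro h0
  have h1 := h.inner_dualCoords x x
  rw [h0, inner_zero_left, h.apply_self] at h1
  exact hx (norm_eq_zero.1 h1.symm)

lemma frameDir_ne_zero (h : IsRadonFrame f u v) (hx : x ≠ 0) : frameDir f u v x ≠ 0 := by
  unfold frameDir
  split_ifs
  exacts [h.primalCoords_ne_zero hx, h.dualCoords_ne_zero hx]

lemma norm_frameMap (h : IsRadonFrame f u v) (x : X) : ‖frameMap f u v x‖ = ‖x‖ := by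
  by_cases hx : x = 0
  · simp [frameMap, hx]
  · have := norm_ne_zero_iff.2 (h.frameDir_ne_zero hx)
    rw [frameMap, norm_smul, norm_smul, norm_inv, norm_norm, norm_norm, inv_mul_cancel₀ this,
      mul_one]

lemma inner_frameDir_nonneg_iff (h : IsRadonFrame f u v) (hx : x ≠ 0) (hy : y ≠ 0) :
    0 ≤ inner ℝ (frameDir f u v x) (frameDir f u v y) ↔ 0 ≤ f x y := by
  have hsx := h.sign_coords hx
  have hsy := h.sign_coords hy
  have hin : ∀ a b : EuclideanSpace ℝ (Fin 2), inner ℝ a b = a 0 * b 0 + a 1 * b 1 := by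
    intro a b
    simp [PiLp.inner_apply, mul_comm]
  have hdual : ∀ {z}, z ≠ 0 → ¬ 0 ≤ f u z * f v z →
      dualCoords f u v z 0 * dualCoords f u v z 1 < 0 := by
    intro z hz hneg
    have h1 : primalCoords f u v z 0 * primalCoords f u v z 1 < 0 := not_le.1 hneg
    rwa [← sign_eq_neg_one_iff, sign_mul, h.sign_coords hz, h.sign_coords hz, ← sign_mul,
      sign_eq_neg_one_iff] at h1
  unfold frameDir
  split_ifs with h1 h2 h2
  · rw [← h.inner_dualCoords x y, hin, hin]
    refine nonneg_add_iff_of_sign_eq ?_ ?_ ?_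
    · rw [sign_mul, sign_mul, hsx]
    · rw [sign_mul, sign_mul, hsx]
    · have h3 : 0 ≤ primalCoords f u v x 0 * primalCoords f u v x 1 := h1
      have h4 : 0 ≤ primalCoords f u v y 0 * primalCoords f u v y 1 := h2
      nlinarith [mul_nonneg h3 h4]
  · rw [real_inner_comm, h.inner_dualCoords, ← sign_nonneg_iff, h.sign_comm y hy x hx,
      sign_nonneg_iff]
  · rw [h.inner_dualCoords]
  · rw [← h.inner_dualCoords x y, hin, hin]
    refine nonneg_add_iff_of_sign_eq ?_ ?_ ?_
    · rw [sign_mul, sign_mul, hsy]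
    · rw [sign_mul, sign_mul, hsy]
    · nlinarith [mul_pos_of_neg_of_neg (hdual hx h1) (hdual hy h2)]

lemma inner_frameMap_nonneg_iff (h : IsRadonFrame f u v) (hx : x ≠ 0) (hy : y ≠ 0) :
    0 ≤ inner ℝ (frameMap f u v x) (frameMap f u v y) ↔ 0 ≤ f x y := by
  have hpos : ∀ {z}, z ≠ 0 → 0 < ‖z‖ * ‖frameDir f u v z‖⁻¹ := fun hz ↦
    mul_pos (norm_pos_iff.2 hz) (inv_pos.2 (norm_pos_iff.2 (h.frameDir_ne_zero hz)))
  rw [← h.inner_frameDir_nonneg_iff hx hy, frameMap, frameMap, smul_smul, smul_smul,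
    real_inner_smul_left, real_inner_smul_right, mul_nonneg_iff_of_pos_left (hpos hx),
    mul_nonneg_iff_of_pos_left (hpos hy)]

lemma posOrth_iff_frameMap [FiniteDimensional ℝ X] (h : IsRadonFrame f u v) (x y : X) :
    PosOrth x y ↔ PosOrth (frameMap f u v x) (frameMap f u v y) := by
  by_cases hx : x = 0
  · subst hx
    simp [PosOrth, frameMap]
  by_cases hy : y = 0
  · subst hy
    simp [PosOrth, frameMap]
  rw [posOrth_iff_inner, h.inner_frameMap_nonneg_iff hx hy, h.posOrth_iff hx]

lemma frameMap_smul_of_pos (h : IsRadonFrame f u v) {c : ℝ} (hc : 0 < c) (x : X) :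
    frameMap f u v (c • x) = c • frameMap f u v x := by
  by_cases hx : x = 0
  · simp [hx, frameMap]
  have hcond : 0 ≤ f u (c • x) * f v (c • x) ↔ 0 ≤ f u x * f v x := by
    rw [map_smul, map_smul, smul_eq_mul, smul_eq_mul, mul_mul_mul_comm,
      mul_nonneg_iff_of_pos_left (mul_pos hc hc)]
  have hprim : primalCoords f u v (c • x) = c • primalCoords f u v x := by
    ext i; fin_cases i <;> simp [primalCoords]
  have hdual : dualCoords f u v (c • x) = dualCoords f u v x := by
    rw [dualCoords, dualCoords, h.smul_of_pos hc hx]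
  unfold frameMap frameDir
  simp only [hcond, hprim, hdual]
  rw [norm_smul, Real.norm_of_nonneg hc.le]
  split_ifs
  · rw [norm_smul, Real.norm_of_nonneg hc.le]
    simp only [smul_smul]
    congr 1
    field_simp
  · simp only [smul_smul, mul_assoc]

lemma frameMap_neg (h : IsRadonFrame f u v) (x : X) :
    frameMap f u v (-x) = -frameMap f u v x := by
  by_cases hx : x = 0
  · simp [hx, frameMap]
  have hdir : frameDir f u v (-x) = -frameDir f u v x := by
    unfold frameDir
    rw [map_neg, map_neg, neg_mul_neg]
    split_ifs
    · ext i; fin_cases i <;> simp [primalCoords]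
    · ext i; fin_cases i <;> simp [dualCoords, h.neg hx]
  rw [frameMap, frameMap, hdir, norm_neg, norm_neg, smul_neg, smul_neg]

lemma frameMap_smul (h : IsRadonFrame f u v) (c : ℝ) (x : X) :
    frameMap f u v (c • x) = c • frameMap f u v x := by
  rcases lt_trichotomy c 0 with hc | rfl | hc
  · rw [← neg_neg (c • x), ← neg_smul, h.frameMap_neg, h.frameMap_smul_of_pos (neg_pos.2 hc),
      neg_smul, neg_neg]
  · simp [frameMap]
  · exact h.frameMap_smul_of_pos hc x

lemma continuous_frameMap [FiniteDimensional ℝ X] (h : IsRadonFrame f u v) :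
    Continuous (frameMap f u v) := by
  classical
  have hprim : Continuous (primalCoords f u v) := by
    unfold primalCoords; fun_prop
  have hdual : ContinuousOn (dualCoords f u v) {0}ᶜ := by
    have hc := h.continuousOn
    have hcoord : ∀ w, ContinuousOn (fun x ↦ f x w) {0}ᶜ := fun w ↦
      hc.clm_apply continuousOn_const
    refine (PiLp.continuous_toLp 2 _).comp_continuousOn (continuousOn_pi.2 fun i ↦ ?_)
    fin_cases i
    exacts [hcoord u, hcoord v]
  have heq : frameMap f u v = fun x ↦ if 0 ≤ f u x * f v x then
      ‖x‖ • ‖primalCoords f u v x‖⁻¹ • primalCoords f u v x else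
      ‖x‖ • ‖dualCoords f u v x‖⁻¹ • dualCoords f u v x := by
    funext x
    unfold frameMap frameDir
    split_ifs <;> rfl
  rw [heq]
  refine Continuous.if_le
    (continuous_norm_smul_inv_norm_smul hprim.continuousOn fun x ↦ h.primalCoords_ne_zero)
    (continuous_norm_smul_inv_norm_smul hdual fun x ↦ h.dualCoords_ne_zero)
    continuous_const (by fun_prop) fun x hx ↦ ?_
  by_cases hx0 : x = 0
  · simp [hx0]
  · rw [inv_norm_smul_eq_of_sign_eq (h.sign_coords hx0) hx.symm]

lemma injective_frameMap (h : IsRadonFrame f u v) : Function.Injective (frameMap f u v) := by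
  intro x y hxy
  by_cases hx : x = 0
  · have h1 := h.norm_frameMap y
    rw [← hxy, h.norm_frameMap, hx, norm_zero] at h1
    rw [hx, norm_eq_zero.1 h1.symm]
  have hy : y ≠ 0 := by
    rintro rfl
    have h1 := h.norm_frameMap x
    rw [hxy, h.norm_frameMap, norm_zero] at h1
    exact hx (norm_eq_zero.1 h1.symm)
  set z : X := f x v • u - f x u • v with hz_def
  have hxz : f x z = 0 := by simp [hz_def, mul_comm]
  have hz : z ≠ 0 := by
    intro hz
    have h1 := congrArg (f u) hz
    have h2 := congrArg (f v) hz
    simp [hz_def, h.apply_left_right, h.apply_right_left, h.apply_self, h.norm_left,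
      h.norm_right] at h1 h2
    exact h.dualCoords_ne_zero hx (by ext i; fin_cases i <;> simp [dualCoords, h1, h2])
  have hiff : ∀ w, w ≠ 0 → (0 ≤ f x w ↔ 0 ≤ f y w) := fun w hw ↦ by
    rw [← h.inner_frameMap_nonneg_iff hx hw, hxy, h.inner_frameMap_nonneg_iff hy hw]
  have hyz : f y z = 0 := by
    refine le_antisymm ?_ ((hiff z hz).1 hxz.ge)
    have := (hiff (-z) (neg_ne_zero.2 hz)).1 (by simp [hxz])
    simpa using this
  have hzero : ∀ w ≠ 0, f w z = 0 → f z w = 0 := fun w hw hwz ↦ by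
    rw [← sign_eq_zero_iff, h.sign_comm z hz w hw, hwz, sign_zero]
  have hzx : f u x * f z u + f v x * f z v = 0 := by
    rw [← hzero x hx hxz]
    conv_rhs => rw [← h.decomp x]
    simp
  have hzy : f u y * f z u + f v y * f z v = 0 := by
    rw [← hzero y hy hyz]
    conv_rhs => rw [← h.decomp y]
    simp
  have hdet : f u x * f v y = f v x * f u y := by
    by_cases hzu : f z u = 0
    · have hzv : f z v ≠ 0 := fun hzv ↦
        h.dualCoords_ne_zero hz (by ext i; fin_cases i <;> simp [dualCoords, hzu, hzv])
      apply mul_left_cancel₀ hzv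
      linear_combination f u x * hzy - f u y * hzx
    · apply mul_left_cancel₀ hzu
      linear_combination f v y * hzx - f v x * hzy
  obtain ⟨c, rfl⟩ : ∃ c : ℝ, y = c • x := by
    by_cases hux : f u x = 0
    · have hvx : f v x ≠ 0 := fun hvx ↦
        h.primalCoords_ne_zero hx (by ext i; fin_cases i <;> simp [primalCoords, hux, hvx])
      refine ⟨f v y / f v x, h.ext ?_ ?_⟩ <;> rw [map_smul, smul_eq_mul] <;> field_simp
      linarith
    · refine ⟨f u y / f u x, h.ext ?_ ?_⟩ <;> rw [map_smul, smul_eq_mul] <;> field_simp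
      linarith
  rw [h.frameMap_smul] at hxy
  have hne : frameMap f u v x ≠ 0 := norm_ne_zero_iff.1 (by
    rw [h.norm_frameMap]; exact norm_ne_zero_iff.2 hx)
  have h1 : (1 - c) • frameMap f u v x = 0 := by rw [sub_smul, one_smul, ← hxy, sub_self]
  have hc : c = 1 := by
    have := (smul_eq_zero.1 h1).resolve_right hne
    linarith
  rw [hc, one_smul]

lemma surjective_frameMap [FiniteDimensional ℝ X] (h : IsRadonFrame f u v) :
    Function.Surjective (frameMap f u v) := by
  intro w
  by_cases hw : w = 0
  · exact ⟨0, by simp [frameMap, hw]⟩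
  suffices hs : ∃ x ≠ 0, SameRay ℝ (frameDir f u v x) w by
    obtain ⟨x, hx, hray⟩ := hs
    refine ⟨(‖w‖ * ‖x‖⁻¹) • x, ?_⟩
    have hx' := norm_ne_zero_iff.2 hx
    have hw' := norm_ne_zero_iff.2 hw
    rw [h.frameMap_smul, frameMap,
      (sameRay_iff_inv_norm_smul_eq_of_ne (h.frameDir_ne_zero hx) hw).1 hray, smul_smul,
      smul_smul]
    have : ‖w‖ * ‖x‖⁻¹ * ‖x‖ * ‖w‖⁻¹ = 1 := by field_simp
    rw [this, one_smul]
  have huu : f u u = 1 := by rw [h.apply_self, h.norm_left]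
  have hvv : f v v = 1 := by rw [h.apply_self, h.norm_right]
  by_cases hpos : 0 ≤ w 0 * w 1
  · have hprim : primalCoords f u v (w 0 • u + w 1 • v) = w := by
      ext i
      fin_cases i <;>
        simp [primalCoords, h.apply_left_right, h.apply_right_left, huu, hvv]
    refine ⟨w 0 • u + w 1 • v, fun h0 ↦ hw ?_, ?_⟩
    · rw [← hprim, h0]
      ext i
      fin_cases i <;> simp [primalCoords]
    · rw [frameDir, if_pos, hprim]
      simpa [h.apply_left_right, h.apply_right_left, huu, hvv] using hpos
  · set φ : X →L[ℝ] ℝ := w 0 • f u + w 1 • f v with hφ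
    have hφu : φ u = w 0 := by simp [hφ, huu, h.apply_right_left]
    have hφv : φ v = w 1 := by simp [hφ, hvv, h.apply_left_right]
    obtain ⟨x, hx1, hmax⟩ := (isCompact_sphere (0 : X) 1).exists_isMaxOn
      ⟨u, by simp [h.norm_left]⟩ φ.continuous.continuousOn
    have hx1 : ‖x‖ = 1 := by simpa using hx1
    have hx : x ≠ 0 := norm_ne_zero_iff.1 (by simp [hx1])
    have hle : ∀ y, φ y ≤ φ x * ‖y‖ := by
      intro y
      by_cases hy : y = 0
      · simp [hy]
      have hy' := norm_pos_iff.2 hy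
      have h1 : φ (‖y‖⁻¹ • y) ≤ φ x := hmax (by simp [norm_smul, hy'.ne'])
      rw [map_smul, smul_eq_mul, inv_mul_le_iff₀ hy'] at h1
      linarith
    have habs : ∀ y, |φ y| ≤ φ x * ‖y‖ := fun y ↦
      abs_le'.2 ⟨hle y, by simpa using hle (-y)⟩
    have hM : 0 < φ x := by
      have h1 := habs u
      rw [hφu, h.norm_left, mul_one] at h1
      refine (abs_pos.2 fun h0 ↦ hpos ?_).trans_le h1
      simp [h0]
    have hfx : (φ x)⁻¹ • φ = f x := by
      refine h.eq_of_apply_eq x hx _ ?_ ?_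
      · refine ContinuousLinearMap.opNorm_le_bound _ zero_le_one fun y ↦ ?_
        rw [smul_apply, smul_eq_mul, norm_mul, norm_inv,
          Real.norm_of_nonneg hM.le, one_mul, inv_mul_le_iff₀ hM]
        exact habs y
      · simp [hx1, hM.ne']
    have hdual : dualCoords f u v x = (φ x)⁻¹ • w := by
      ext i
      fin_cases i <;> simp [dualCoords, ← hfx, hφu, hφv]
    refine ⟨x, hx, ?_⟩
    rw [frameDir, if_neg, hdual]
    · exact SameRay.sameRay_pos_smul_left w (inv_pos.2 hM)
    · change ¬ 0 ≤ primalCoords f u v x 0 * primalCoords f u v x 1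
      rw [← sign_nonneg_iff, sign_mul, h.sign_coords hx, h.sign_coords hx, ← sign_mul,
        sign_nonneg_iff, hdual]
      simp only [PiLp.smul_apply, smul_eq_mul]
      rwa [mul_mul_mul_comm,
        mul_nonneg_iff_of_pos_left (mul_pos (inv_pos.2 hM) (inv_pos.2 hM))]

end IsRadonFrame

/-- A norm-preserving continuous bijection between proper normed spaces is a homeomorphism. -/
lemma exists_homeomorph_of_norm_eq {X E : Type*} [NormedAddCommGroup X] [ProperSpace X]
    [NormedAddCommGroup E] [ProperSpace E] {S : X → E} (hc : Continuous S)
    (hb : Function.Bijective S) (hn : ∀ x, ‖S x‖ = ‖x‖) : ∃ T : X ≃ₜ E, ∀ x, T x = S x := by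
  have hclosed : IsClosedMap S := by
    refine (isProperMap_iff_tendsto_cocompact.2 ⟨hc, ?_⟩).isClosedMap
    rw [← Metric.cobounded_eq_cocompact, ← Metric.cobounded_eq_cocompact,
      ← tendsto_norm_atTop_iff_cobounded]
    simpa only [hn] using tendsto_norm_cobounded_atTop (E := X)
  exact ⟨(Equiv.ofBijective S hb).toHomeomorphOfContinuousClosed hc hclosed, fun _ ↦ rfl⟩

/-- For a smooth Radon plane `X` not isometric to the Euclidean plane, `X ⊕_∞ c₀(I)` is
strongly Birkhoff–James isomorphic to `ℓ₂² ⊕_∞ c₀(I)` but not isometrically isomorphic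
to it. Here `X ⊕_∞ Y` is realized as `X × Y` with the max norm and `c₀(I)` as
`C₀(I, ℝ)` with `I` discrete. -/
theorem smooth_radon_plane_inf_sum_c0_bj_eq_but_not_isometric
    {X : Type*} [NormedAddCommGroup X] [NormedSpace ℝ X] [CompleteSpace X]
    (hdim : Module.finrank ℝ X = 2) (hsmooth : SmoothSpace X)
    (hradon : ∀ x y : X, BJOrth x y → BJOrth y x)
    (hnotiso : ¬ Nonempty (X ≃ₗᵢ[ℝ] EuclideanSpace ℝ (Fin 2)))
    (I : Type*) [TopologicalSpace I] [DiscreteTopology I] [Nonempty I] :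
    BJStrongIso (X × C₀(I, ℝ)) (EuclideanSpace ℝ (Fin 2) × C₀(I, ℝ)) ∧
      ¬ Nonempty ((X × C₀(I, ℝ)) ≃ₗᵢ[ℝ] (EuclideanSpace ℝ (Fin 2) × C₀(I, ℝ))) := by
  have : FiniteDimensional ℝ X := Module.finite_of_finrank_pos (by omega)
  constructor
  · obtain ⟨f, u, v, h⟩ := exists_isRadonFrame hdim hsmooth hradon
    have : ProperSpace X := FiniteDimensional.proper ℝ X
    obtain ⟨S, hS⟩ := exists_homeomorph_of_norm_eq h.continuous_frameMap
      ⟨h.injective_frameMap, h.surjective_frameMap⟩ h.norm_frameMap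
    refine bjStrongIso_prod S (fun x ↦ ?_) (fun c x ↦ ?_) fun x y ↦ ?_
    · rw [hS, h.norm_frameMap]
    · rw [hS, hS, h.frameMap_smul]
    · rw [hS, hS, h.posOrth_iff_frameMap]
  · rintro ⟨T⟩
    exact hnotiso (nonempty_linearIsometryEquiv_of_prod_c0 (by simp) (by simp [hdim]) T)
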